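/- Let n ≥ 1 and k ≥ 1. For any pairwise distinct points p₁, …, p_k ∈ ℝ^{2n} and any pairwise distinct points q₁, …, q_k ∈ ℝ^{2n}, there exists a compactly supported symplectomorphism γ of ℝ^{2n} with γ(pᵢ) = qᵢ for all i = 1, …, k. -/

import Mathlib

open MeasureTheory

/-- `ℝ²ⁿ = ℝⁿ × ℝⁿ` with the Euclidean norm. -/
abbrev E (n : ℕ) := EuclideanSpace ℝ (Fin n ⊕ Fin n)

/-- The standard symplectic form `ω₀((u,v),(u',v')) = ⟨u,v'⟩ - ⟨v,u'⟩` on `ℝ²ⁿ`,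
where the first `ℝⁿ` factor is indexed by `Sum.inl` and the second by `Sum.inr`. -/
def omega0 {n : ℕ} (w w' : E n) : ℝ :=
  ∑ i : Fin n, (w (Sum.inl i) * w' (Sum.inr i) - w (Sum.inr i) * w' (Sum.inl i))

/-- A compactly supported symplectomorphism of `(ℝ²ⁿ, ω₀)`: a `C^∞` diffeomorphism
whose support has compact closure and whose derivative preserves `ω₀` everywhere. -/
structure CSSymplectomorphism (n : ℕ) where
  toFun : E n → E n
  invFun : E n → E n
  left_inv : Function.LeftInverse invFun toFun
  right_inv : Function.RightInverse invFun toFun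
  smooth : ContDiff ℝ (⊤ : ℕ∞) toFun
  smooth_inv : ContDiff ℝ (⊤ : ℕ∞) invFun
  compactSupp : IsCompact (closure {p | toFun p ≠ p})
  symplectic : ∀ p w w',
    omega0 (fderiv ℝ toFun p w) (fderiv ℝ toFun p w') = omega0 w w'

/-- The complex structure `(u, v) ↦ (-v, u)` on `ℝ²ⁿ`. -/
noncomputable def complexStructure (n : ℕ) : E n →L[ℝ] E n :=
  LinearMap.toContinuousLinearMap
    { toFun := fun w => WithLp.toLp 2
        (Sum.elim (fun i => -w (Sum.inr i)) (fun i => w (Sum.inl i)))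
      map_add' := fun w w' => by
        ext (i | i) <;> simp [add_comm]
      map_smul' := fun a w => by
        ext (i | i) <;> simp }

@[simp]
lemma complexStructure_inl {n : ℕ} (w : E n) (i : Fin n) :
    complexStructure n w (Sum.inl i) = -w (Sum.inr i) := rfl

@[simp]
lemma complexStructure_inr {n : ℕ} (w : E n) (i : Fin n) :
    complexStructure n w (Sum.inr i) = w (Sum.inl i) := rfl

@[simp]
lemma complexStructure_complexStructure {n : ℕ} (w : E n) :
    complexStructure n (complexStructure n w) = -w := by
  ext (i | i) <;> simp

lemma omega0_eq_inner {n : ℕ} (w w' : E n) :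
    omega0 w w' = inner ℝ (complexStructure n w) w' := by
  simp only [omega0, PiLp.inner_apply, Fintype.sum_sum_type, complexStructure_inl,
    complexStructure_inr, ← Finset.sum_add_distrib]
  refine Finset.sum_congr rfl fun i _ => ?_
  simp
  ring

lemma inner_complexStructure_complexStructure {n : ℕ} (w w' : E n) :
    inner ℝ (complexStructure n w) (complexStructure n w') = inner ℝ w w' := by
  simp only [PiLp.inner_apply, Fintype.sum_sum_type, complexStructure_inl,
    complexStructure_inr]
  simp [add_comm]

lemma inner_complexStructure_left {n : ℕ} (w w' : E n) :
    inner ℝ (complexStructure n w) w' = -inner ℝ w (complexStructure n w') := by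
  rw [← inner_complexStructure_complexStructure w]
  simp

lemma inner_complexStructure_self {n : ℕ} (w : E n) :
    inner ℝ (complexStructure n w) w = 0 := by
  have h := inner_complexStructure_left w w
  rw [real_inner_comm (complexStructure n w) w] at h
  linarith

/-- Multiplication by the complex number `exp (i t)`. -/
noncomputable def complexRotation {n : ℕ} (t : ℝ) (w : E n) : E n :=
  Real.cos t • w + Real.sin t • complexStructure n w

lemma norm_sq_complexRotation {n : ℕ} (t : ℝ) (w : E n) :
    ‖complexRotation t w‖ ^ 2 = ‖w‖ ^ 2 := by
  simp only [complexRotation, ← real_inner_self_eq_norm_sq, inner_add_left, inner_add_right,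
    real_inner_smul_left, real_inner_smul_right, inner_complexStructure_complexStructure,
    inner_complexStructure_self, real_inner_comm (complexStructure n w) w]
  linear_combination (inner ℝ w w) * Real.sin_sq_add_cos_sq t

lemma complexRotation_neg_complexRotation {n : ℕ} (t : ℝ) (w : E n) :
    complexRotation (-t) (complexRotation t w) = w := by
  simp only [complexRotation, Real.cos_neg, Real.sin_neg, map_add, map_smul,
    complexStructure_complexStructure]
  have h : w = (Real.sin t ^ 2 + Real.cos t ^ 2) • w := by
    rw [Real.sin_sq_add_cos_sq, one_smul]
  conv_rhs => rw [h]
  module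

/-- The twist about `c` rotating the sphere of squared radius `s` by the angle `θ s`. -/
noncomputable def twist {n : ℕ} (c : E n) (θ : ℝ → ℝ) (z : E n) : E n :=
  c + complexRotation (θ (‖z - c‖ ^ 2)) (z - c)

lemma twist_neg_twist {n : ℕ} (c : E n) (θ : ℝ → ℝ) (z : E n) :
    twist c (-θ) (twist c θ z) = z := by
  simp [twist, norm_sq_complexRotation, complexRotation_neg_complexRotation]

lemma twist_of_eq_zero {n : ℕ} {c : E n} {θ : ℝ → ℝ} {z : E n} (h : θ (‖z - c‖ ^ 2) = 0) :
    twist c θ z = z := by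
  simp [twist, complexRotation, h]

lemma contDiff_twist {n : ℕ} (c : E n) {θ : ℝ → ℝ} (hθ : ContDiff ℝ (⊤ : ℕ∞) θ) :
    ContDiff ℝ (⊤ : ℕ∞) (twist c θ) := by
  have h : ContDiff ℝ (⊤ : ℕ∞) fun z : E n => θ (‖z - c‖ ^ 2) :=
    hθ.comp ((contDiff_id.sub contDiff_const).norm_sq ℝ)
  have hJ : ContDiff ℝ (⊤ : ℕ∞) fun z : E n => complexStructure n (z - c) :=
    (complexStructure n).contDiff.comp (contDiff_id.sub contDiff_const)
  exact contDiff_const.add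
    (((Real.contDiff_cos.comp h).smul (contDiff_id.sub contDiff_const)).add
      ((Real.contDiff_sin.comp h).smul hJ))

lemma fderiv_twist {n : ℕ} (c : E n) {θ : ℝ → ℝ} (hθ : Differentiable ℝ θ) (z w : E n) :
    fderiv ℝ (twist c θ) z w = complexRotation (θ (‖z - c‖ ^ 2))
      (w + (2 * deriv θ (‖z - c‖ ^ 2) * inner ℝ (z - c) w) • complexStructure n (z - c)) := by
  have hy : HasFDerivAt (fun z : E n => z - c) (ContinuousLinearMap.id ℝ (E n)) z :=
    (hasFDerivAt_id z).sub_const c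
  have hθ' := (hθ (‖z - c‖ ^ 2)).hasDerivAt.comp_hasFDerivAt z hy.norm_sq
  have hJ := (complexStructure n).hasFDerivAt.comp z hy
  have h := ((hθ'.cos.smul hy).add (hθ'.sin.smul hJ)).const_add c
  have hfun : HasFDerivAt (twist c θ) _ z := h
  rw [hfun.fderiv]
  simp [complexRotation, inner_sub_left]
  module

lemma omega0_complexRotation {n : ℕ} (t : ℝ) (w w' : E n) :
    omega0 (complexRotation t w) (complexRotation t w') = omega0 w w' := by
  simp only [omega0_eq_inner, complexRotation, map_add, map_smul, inner_add_left,
    inner_add_right, real_inner_smul_left, real_inner_smul_right,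
    complexStructure_complexStructure, inner_complexStructure_complexStructure, inner_neg_left,
    inner_complexStructure_left w w']
  linear_combination
    (-inner ℝ w (complexStructure n w')) * Real.sin_sq_add_cos_sq t

lemma omega0_fderiv_twist {n : ℕ} (c : E n) {θ : ℝ → ℝ} (hθ : Differentiable ℝ θ)
    (z w w' : E n) :
    omega0 (fderiv ℝ (twist c θ) z w) (fderiv ℝ (twist c θ) z w') = omega0 w w' := by
  rw [fderiv_twist c hθ, fderiv_twist c hθ, omega0_complexRotation]
  simp only [omega0_eq_inner, map_add, map_smul, inner_add_left, inner_add_right,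
    real_inner_smul_left, real_inner_smul_right, complexStructure_complexStructure,
    inner_complexStructure_complexStructure, inner_neg_left, real_inner_comm (z - c) w]
  rw [real_inner_comm (complexStructure n (z - c)) (z - c), inner_complexStructure_self]
  ring

namespace CSSymplectomorphism

/-- The identity. -/
def refl (n : ℕ) : CSSymplectomorphism n where
  toFun := id
  invFun := id
  left_inv _ := rfl
  right_inv _ := rfl
  smooth := contDiff_id
  smooth_inv := contDiff_id
  compactSupp := by simp
  symplectic p w w' := by simp

/-- The composition `η ∘ γ`. -/
def trans {n : ℕ} (γ η : CSSymplectomorphism n) : CSSymplectomorphism n where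
  toFun := η.toFun ∘ γ.toFun
  invFun := γ.invFun ∘ η.invFun
  left_inv := η.left_inv.comp γ.left_inv
  right_inv := η.right_inv.comp γ.right_inv
  smooth := η.smooth.comp γ.smooth
  smooth_inv := γ.smooth_inv.comp η.smooth_inv
  compactSupp := by
    refine (γ.compactSupp.union η.compactSupp).of_isClosed_subset isClosed_closure ?_
    rw [← closure_union]
    refine closure_mono fun p hp => ?_
    by_cases h : γ.toFun p = p
    · exact Or.inr (by simpa [h] using hp)
    · exact Or.inl h
  symplectic p w w' := by
    have hη : DifferentiableAt ℝ η.toFun (γ.toFun p) :=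
      η.smooth.differentiable (by simp) _
    have hγ : DifferentiableAt ℝ γ.toFun p := γ.smooth.differentiable (by simp) _
    rw [fderiv_comp p hη hγ]
    simp only [ContinuousLinearMap.comp_apply, η.symplectic, γ.symplectic]

/-- A twist with compactly supported angle function. -/
noncomputable def ofTwist {n : ℕ} (c : E n) (θ : ℝ → ℝ) (hθ : ContDiff ℝ (⊤ : ℕ∞) θ)
    (hsupp : HasCompactSupport θ) : CSSymplectomorphism n where
  toFun := twist c θ
  invFun := twist c (-θ)
  left_inv := twist_neg_twist c θ
  right_inv z := by simpa using twist_neg_twist c (-θ) z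
  smooth := contDiff_twist c hθ
  smooth_inv := contDiff_twist c hθ.neg
  compactSupp := by
    obtain ⟨R, hR⟩ := hsupp.isCompact.isBounded.subset_closedBall 0
    refine (isCompact_closedBall c (|R| + 1)).of_isClosed_subset isClosed_closure
      (closure_minimal (fun z hz => ?_) Metric.isClosed_closedBall)
    have hmem : ‖z - c‖ ^ 2 ∈ tsupport θ :=
      subset_tsupport θ fun h => hz (twist_of_eq_zero h)
    have hle := hR hmem
    rw [mem_closedBall_zero_iff, Real.norm_of_nonneg (by positivity)] at hle
    rw [mem_closedBall_iff_norm]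
    nlinarith [le_abs_self R, abs_nonneg R]
  symplectic := omega0_fderiv_twist c (hθ.differentiable (by simp))

/-- Two points are exchanged by a half-turn about their midpoint, performed near the sphere
of which they are antipodes. -/
lemma exists_apply_eq_of_inner_ne_zero {n : ℕ} (F : Finset (E n)) (a b : E n)
    (h : ∀ f ∈ F, inner ℝ (f - a) (f - b) ≠ 0) :
    ∃ γ : CSSymplectomorphism n, γ.toFun a = b ∧ ∀ f ∈ F, γ.toFun f = f := by
  obtain ⟨c, y, rfl, rfl⟩ : ∃ c y : E n, a = c + y ∧ b = c - y :=
    ⟨(1 / 2 : ℝ) • (a + b), (1 / 2 : ℝ) • (a - b), by module, by module⟩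
  have hT : ((F.image fun f => ‖f - c‖ ^ 2 : Finset ℝ) : Set ℝ)ᶜ ∈ nhds (‖y‖ ^ 2) := by
    refine (Finset.finite_toSet _).isClosed.isOpen_compl.mem_nhds fun hy => ?_
    obtain ⟨f, hf, hfy⟩ := Finset.mem_image.1 (Finset.mem_coe.1 hy)
    refine h f hf ?_
    rw [← sub_sub, sub_sub_eq_add_sub, add_sub_right_comm, real_inner_comm,
      real_inner_add_sub_eq_zero_iff]
    exact (sq_eq_sq₀ (norm_nonneg _) (norm_nonneg _)).1 hfy
  obtain ⟨θ, hθT, hθc, hθs, -, hθ1⟩ := exists_contDiff_tsupport_subset (n := ⊤) hT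
  refine ⟨ofTwist c (fun s => Real.pi * θ s) (contDiff_const.mul hθs)
    (hθc.mul_left (f := fun _ => Real.pi)), ?_, fun f hf => ?_⟩
  · simp [ofTwist, twist, complexRotation, hθ1, sub_eq_add_neg]
  · refine twist_of_eq_zero (c := c) (θ := fun s => Real.pi * θ s) ?_
    have : θ (‖f - c‖ ^ 2) = 0 := by
      by_contra hne
      exact hθT (subset_tsupport θ hne)
        (Finset.mem_coe.2 (Finset.mem_image_of_mem (fun f => ‖f - c‖ ^ 2) hf))
    simp [this]

end CSSymplectomorphism

lemma ae_inner_sub_sub_ne_zero {V : Type*} [NormedAddCommGroup V] [InnerProductSpace ℝ V]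
    [FiniteDimensional ℝ V] [MeasurableSpace V] [BorelSpace V] {a f : V} (h : f ≠ a) :
    ∀ᵐ m : V, inner ℝ (f - a) (f - m) ≠ 0 := by
  have hne : AffineSubspace.mk' f (ℝ ∙ (f - a))ᗮ ≠ ⊤ := fun htop => by
    have ha : a ∈ AffineSubspace.mk' f (ℝ ∙ (f - a))ᗮ := htop ▸ AffineSubspace.mem_top ℝ V a
    rw [AffineSubspace.mem_mk', vsub_eq_sub, Submodule.mem_orthogonal_singleton_iff_inner_right,
      ← neg_sub f a, inner_neg_right, neg_eq_zero, inner_self_eq_zero, sub_eq_zero] at ha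
    exact h ha
  refine measure_mono_null (fun m hm => ?_) (Measure.addHaar_affineSubspace volume _ hne)
  have hm' : inner ℝ (f - a) (f - m) = 0 := by simpa using hm
  rw [SetLike.mem_coe, AffineSubspace.mem_mk', vsub_eq_sub,
    Submodule.mem_orthogonal_singleton_iff_inner_right, ← neg_sub f m, inner_neg_right, hm',
    neg_zero]

namespace CSSymplectomorphism

lemma exists_apply_eq_of_notMem {n : ℕ} (F : Finset (E n)) {a b : E n} (ha : a ∉ F)
    (hb : b ∉ F) :
    ∃ γ : CSSymplectomorphism n, γ.toFun a = b ∧ ∀ f ∈ F, γ.toFun f = f := by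
  have hae : ∀ᵐ m : E n, ∀ f ∈ F,
      inner ℝ (f - a) (f - m) ≠ 0 ∧ inner ℝ (f - b) (f - m) ≠ 0 :=
    (Filter.eventually_all_finset F).2 fun f hf =>
      (ae_inner_sub_sub_ne_zero (ne_of_mem_of_not_mem hf ha)).and
        (ae_inner_sub_sub_ne_zero (ne_of_mem_of_not_mem hf hb))
  obtain ⟨m, hm⟩ := hae.exists
  obtain ⟨γ, hγ, hγF⟩ := exists_apply_eq_of_inner_ne_zero F a m fun f hf => (hm f hf).1
  obtain ⟨η, hη, hηF⟩ := exists_apply_eq_of_inner_ne_zero F m b fun f hf => by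
    rw [real_inner_comm]
    exact (hm f hf).2
  refine ⟨γ.trans η, by simp [trans, hγ, hη], fun f hf => ?_⟩
  simp [trans, hγF f hf, hηF f hf]

end CSSymplectomorphism

/-- The group of compactly supported symplectomorphisms of `ℝ²ⁿ` acts
`k`-transitively for every `k ≥ 1`. -/
theorem csSymplectomorphism_k_transitive
    (n : ℕ) (hn : 1 ≤ n) (k : ℕ) (hk : 1 ≤ k)
    (p q : Fin k → E n) (hp : Function.Injective p) (hq : Function.Injective q) :
    ∃ γ : CSSymplectomorphism n, ∀ i, γ.toFun (p i) = q i := by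
  classical
  suffices h : ∀ s : Finset (Fin k), ∃ γ : CSSymplectomorphism n, ∀ i ∈ s, γ.toFun (p i) = q i by
    simpa using h Finset.univ
  intro s
  induction s using Finset.induction_on with
  | empty => exact ⟨CSSymplectomorphism.refl n, by simp⟩
  | insert j s hj ih =>
    obtain ⟨γ, hγ⟩ := ih
    have ha : γ.toFun (p j) ∉ s.image q := fun hmem => by
      obtain ⟨i, hi, hiq⟩ := Finset.mem_image.1 hmem
      rw [← hγ i hi] at hiq
      exact hj (hp (γ.left_inv.injective hiq) ▸ hi)
    have hb : q j ∉ s.image q := fun hmem => by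
      obtain ⟨i, hi, hiq⟩ := Finset.mem_image.1 hmem
      exact hj (hq hiq ▸ hi)
    obtain ⟨η, hη, hηF⟩ := CSSymplectomorphism.exists_apply_eq_of_notMem _ ha hb
    refine ⟨γ.trans η, fun i hi => ?_⟩
    rcases Finset.mem_insert.1 hi with rfl | hi
    · exact hη
    · change η.toFun (γ.toFun (p i)) = q i
      rw [hγ i hi, hηF _ (Finset.mem_image_of_mem q hi)]
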